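/- If D ⊊ ℂ is a domain and f is conformal on D, then for all z₁, z₂ ∈ D, (1/4) k_D(z₁,z₂) ≤ k_{f(D)}(f(z₁), f(z₂)) ≤ 4 k_D(z₁,z₂), where k_Ω denotes the quasihyperbolic distance. -/

import Mathlib

/-- The quasihyperbolic distance on a region `Ω ⊂ ℂ`: the infimum over (C¹)
rectifiable paths `γ` in `Ω` joining `a` to `b` of `∫_γ |dw| / dist(w, ∂Ω)`. -/
noncomputable def qhDist (Ω : Set ℂ) (a b : ℂ) : ℝ :=
  sInf {L : ℝ | ∃ γ : ℝ → ℂ, ContDiffOn ℝ 1 γ (Set.Icc 0 1) ∧ γ 0 = a ∧ γ 1 = b ∧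
    (∀ t ∈ Set.Icc (0 : ℝ) 1, γ t ∈ Ω) ∧
    L = ∫ t in (0 : ℝ)..1, ‖deriv γ t‖ / Metric.infDist (γ t) (frontier Ω)}

open MeasureTheory Set Metric Filter Topology
open scoped ENNReal Real ComplexConjugate

theorem lintegral_annulus_eq {φ : ℂ → ℝ≥0∞} (hφ : Measurable φ) {ε r : ℝ} (hε : 0 ≤ ε) :
    ∫⁻ z in {z : ℂ | ε < ‖z‖ ∧ ‖z‖ < r}, φ z =
      ∫⁻ ρ in Ioo ε r, ENNReal.ofReal ρ * ∫⁻ θ in Ioo (-π) π, φ (circleMap 0 ρ θ) := by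
  have hA : MeasurableSet {z : ℂ | ε < ‖z‖ ∧ ‖z‖ < r} :=
    ((isOpen_lt continuous_const continuous_norm).inter
      (isOpen_lt continuous_norm continuous_const)).measurableSet
  have hsymm : ∀ p : ℝ × ℝ, Complex.polarCoord.symm p = circleMap 0 p.1 p.2 := by
    intro p
    simp [circleMap, Complex.exp_mul_I]
  have hmeas : Measurable fun p : ℝ × ℝ => circleMap 0 p.1 p.2 := by
    unfold circleMap
    fun_prop
  rw [← lintegral_indicator hA, ← Complex.lintegral_comp_polarCoord_symm]
  simp_rw [hsymm]
  rw [polarCoord_target, Measure.volume_eq_prod, ← Measure.prod_restrict, lintegral_prod]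
  · rw [← lintegral_indicator measurableSet_Ioi, ← lintegral_indicator measurableSet_Ioo]
    congr 1
    ext ρ
    by_cases hρ : 0 < ρ
    · by_cases h : ρ ∈ Ioo ε r
      · rw [indicator_of_mem (show ρ ∈ Ioi 0 from hρ), indicator_of_mem h,
          ← lintegral_const_mul _ (by fun_prop)]
        refine lintegral_congr fun θ => ?_
        rw [indicator_of_mem]
        · rfl
        · simpa [abs_of_pos hρ] using h
      · rw [indicator_of_mem (show ρ ∈ Ioi 0 from hρ), indicator_of_notMem h,
          ← lintegral_zero (μ := volume.restrict (Ioo (-π) π))]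
        refine lintegral_congr fun θ => ?_
        rw [indicator_of_notMem]
        · simp
        · simpa [abs_of_pos hρ] using h
    · rw [indicator_of_notMem (by simpa using hρ), indicator_of_notMem]
      intro h
      exact hρ (hε.trans_lt h.1)
  · exact (by fun_prop : Measurable fun p : ℝ × ℝ => ENNReal.ofReal p.1).aemeasurable.smul
      ((hφ.indicator hA).comp hmeas).aemeasurable

theorem le_circleAverage_norm_sq {v : ℂ → ℂ} (hv : DifferentiableOn ℂ v (ball 0 1)) {ρ : ℝ}
    (hρ : 0 < ρ) (hρ1 : ρ < 1) :
    (ρ ^ 4)⁻¹ + ‖v 0‖ ^ 2 ≤ Real.circleAverage (fun z => ‖v z - (z ^ 2)⁻¹‖ ^ 2) 0 ρ := by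
  set b := v 0
  let Φ : ℂ → ℂ := fun z => ((ρ ^ 4)⁻¹ - ‖b‖ ^ 2 : ℝ) + v z * (2 * conj b - 2 * z ^ 2 / ρ ^ 4)
  have hsub : closedBall (0 : ℂ) |ρ| ⊆ ball 0 1 := by
    rw [abs_of_pos hρ]
    exact closedBall_subset_ball hρ1
  have hΦ : DifferentiableOn ℂ Φ (ball 0 1) := by
    unfold Φ
    fun_prop
  have hs : sphere (0 : ℂ) |ρ| ⊆ ball 0 1 := sphere_subset_closedBall.trans hsub
  have hmean : Real.circleAverage Φ 0 ρ = Φ 0 := by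
    apply DiffContOnCl.circleAverage
    refine ⟨hΦ.mono (ball_subset_closedBall.trans hsub), hΦ.continuousOn.mono ?_⟩
    exact closure_ball_subset_closedBall.trans hsub
  have hΦi : CircleIntegrable Φ 0 ρ := (hΦ.continuousOn.mono hs).circleIntegrable'
  have hre : Real.circleAverage (fun z => (Φ z).re) 0 ρ = (Φ 0).re := by
    rw [← hmean]
    exact Complex.reCLM.circleAverage_comp_comm hΦi
  have h0 : (Φ 0).re = (ρ ^ 4)⁻¹ + ‖b‖ ^ 2 := by
    have : Φ 0 = ((ρ ^ 4)⁻¹ + ‖b‖ ^ 2 : ℝ) := by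
      simp only [Φ]
      have := Complex.mul_conj' b
      push_cast
      change _ + b * _ = _
      linear_combination 2 * this
    rw [this, Complex.ofReal_re]
  rw [← h0, ← hre]
  apply Real.circleAverage_mono
  · exact (Complex.continuous_re.comp_continuousOn (hΦ.continuousOn.mono hs)).circleIntegrable'
  · apply ContinuousOn.circleIntegrable'
    refine (ContinuousOn.norm (ContinuousOn.sub (hv.continuousOn.mono hs) ?_)).pow 2
    refine ContinuousOn.inv₀ (by fun_prop) fun z hz => ?_
    have : z ≠ 0 := by
      rintro rfl
      simp at hz
      exact (abs_pos.2 hρ.ne').ne hz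
    positivity
  · intro z hz
    have hz' : ‖z‖ = ρ := by simpa [abs_of_pos hρ] using hz
    have hzz : z * conj z = ρ ^ 2 := by rw [Complex.mul_conj', hz']
    have hz0 : z ≠ 0 := by
      rintro rfl
      simp at hz'
      exact hρ.ne hz'
    have hρc : (ρ : ℂ) ≠ 0 := by exact_mod_cast hρ.ne'
    have hinv : z ^ 2 / ρ ^ 4 = conj ((z ^ 2)⁻¹) := by
      have : conj z ≠ 0 := by simpa using hz0
      rw [map_inv₀, map_pow]
      field_simp
      linear_combination (z * conj z + ρ ^ 2) * hzz
    have hn : ‖(z ^ 2)⁻¹‖ ^ 2 = (ρ ^ 4)⁻¹ := by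
      rw [norm_inv, norm_pow, hz', inv_pow, ← pow_mul]
    have key : (Φ z).re = (ρ ^ 4)⁻¹ - ‖b‖ ^ 2 + 2 * (v z * conj b).re
        - 2 * (v z * conj ((z ^ 2)⁻¹)).re := by
      have : Φ z = (((ρ ^ 4)⁻¹ - ‖b‖ ^ 2 : ℝ) : ℂ) + (2 : ℝ) * (v z * conj b)
        - (2 : ℝ) * (v z * conj ((z ^ 2)⁻¹)) := by
        rw [← hinv]
        simp only [Φ]
        push_cast
        ring
      rw [this, Complex.sub_re, Complex.add_re, Complex.re_ofReal_mul, Complex.re_ofReal_mul,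
        Complex.ofReal_re]
    have e2 : ‖v z - (z ^ 2)⁻¹‖ ^ 2 = ‖v z‖ ^ 2 + (ρ ^ 4)⁻¹ - 2 * (v z * conj ((z ^ 2)⁻¹)).re := by
      rw [← hn, ← Complex.normSq_eq_norm_sq, ← Complex.normSq_eq_norm_sq,
        ← Complex.normSq_eq_norm_sq, Complex.normSq_sub]
    have e3 : 0 ≤ ‖v z‖ ^ 2 + ‖b‖ ^ 2 - 2 * (v z * conj b).re := by
      rw [← Complex.normSq_eq_norm_sq, ← Complex.normSq_eq_norm_sq, ← Complex.normSq_sub]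
      exact Complex.normSq_nonneg _
    change (Φ z).re ≤ _
    rw [key]
    linarith

theorem ofReal_le_lintegral_annulus {v : ℂ → ℂ} (hv : DifferentiableOn ℂ v (ball 0 1))
    (hvm : Measurable v) {ε r : ℝ} (hε : 0 < ε) (hεr : ε ≤ r) (hr : r < 1) :
    ENNReal.ofReal (π * ((ε ^ 2)⁻¹ - (r ^ 2)⁻¹ + ‖v 0‖ ^ 2 * (r ^ 2 - ε ^ 2))) ≤
      ∫⁻ z in {z : ℂ | ε < ‖z‖ ∧ ‖z‖ < r}, ENNReal.ofReal (‖v z - (z ^ 2)⁻¹‖ ^ 2) := by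
  rw [lintegral_annulus_eq (by fun_prop) hε.le]
  have hinner : ∀ ρ ∈ Ioo ε r, ENNReal.ofReal (ρ * (2 * π * ((ρ ^ 4)⁻¹ + ‖v 0‖ ^ 2))) ≤
      ENNReal.ofReal ρ * ∫⁻ θ in Ioo (-π) π,
        ENNReal.ofReal (‖v (circleMap 0 ρ θ) - (circleMap 0 ρ θ ^ 2)⁻¹‖ ^ 2) := by
    intro ρ hρ
    have hρ0 : 0 < ρ := hε.trans hρ.1
    rw [ENNReal.ofReal_mul hρ0.le]
    gcongr
    have h := le_circleAverage_norm_sq hv hρ0 (hρ.2.trans hr)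
    rw [Real.circleAverage_eq_integral_add (-π), smul_eq_mul,
      intervalIntegral.integral_comp_add_right
        (fun θ => ‖v (circleMap 0 ρ θ) - (circleMap 0 ρ θ ^ 2)⁻¹‖ ^ 2),
      inv_mul_eq_div, le_div_iff₀' (by positivity)] at h
    refine (ENNReal.ofReal_le_ofReal h).trans (le_of_eq ?_)
    rw [zero_add, show 2 * π + -π = π by ring,
      intervalIntegral.integral_of_le (by linarith [Real.pi_pos]), integral_Ioc_eq_integral_Ioo,
      ofReal_integral_eq_lintegral_ofReal]
    · rw [← IntegrableOn, ← integrableOn_Icc_iff_integrableOn_Ioo]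
      apply ContinuousOn.integrableOn_Icc
      refine (ContinuousOn.norm (ContinuousOn.sub ?_ ?_)).pow 2
      · refine hv.continuousOn.comp (by fun_prop) fun θ _ => ?_
        simpa [abs_of_pos hρ0] using hρ.2.trans hr
      · refine ContinuousOn.inv₀ (by fun_prop) fun θ _ => ?_
        exact pow_ne_zero 2 (circleMap_ne_center hρ0.ne')
    · exact Eventually.of_forall fun _ => by positivity
  refine le_trans (le_of_eq ?_) (setLIntegral_mono' measurableSet_Ioo hinner)
  have hcont : ContinuousOn (fun ρ : ℝ => ρ * (2 * π * ((ρ ^ 4)⁻¹ + ‖v 0‖ ^ 2))) (Icc ε r) := by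
    refine continuousOn_id.mul (continuousOn_const.mul (ContinuousOn.add ?_ continuousOn_const))
    refine ContinuousOn.inv₀ (by fun_prop) fun ρ hρ => ?_
    exact pow_ne_zero 4 (hε.trans_le hρ.1).ne'
  rw [← ofReal_integral_eq_lintegral_ofReal, ← integral_Ioc_eq_integral_Ioo,
    ← intervalIntegral.integral_of_le hεr]
  · congr 1
    rw [intervalIntegral.integral_eq_sub_of_hasDerivAt
      (f := fun ρ : ℝ => π * (-(ρ ^ 2)⁻¹ + ‖v 0‖ ^ 2 * ρ ^ 2))]
    · ring
    · intro ρ hρ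
      rw [uIcc_of_le hεr] at hρ
      have hρ0 : ρ ≠ 0 := (hε.trans_le hρ.1).ne'
      have h1 : HasDerivAt (fun ρ : ℝ => ρ ^ 2) (2 * ρ) ρ := by simpa using hasDerivAt_pow 2 ρ
      refine (((h1.inv (pow_ne_zero 2 hρ0)).neg.add (h1.const_mul (‖v 0‖ ^ 2))).const_mul
        π).congr_deriv ?_
      field_simp
    · apply ContinuousOn.intervalIntegrable
      rwa [uIcc_of_le hεr]
  · rw [← IntegrableOn, ← integrableOn_Icc_iff_integrableOn_Ioo]
    exact hcont.integrableOn_Icc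
  · refine (ae_restrict_iff' measurableSet_Ioo).2 (Eventually.of_forall fun ρ hρ => ?_)
    have hρ0 : 0 < ρ := hε.trans hρ.1
    positivity

theorem det_id_sub_smul_conj (c : ℂ) :
    LinearMap.det (LinearMap.id - c • (Complex.conjAe.toLinearMap : ℂ →ₗ[ℝ] ℂ)) =
      1 - ‖c‖ ^ 2 := by
  rw [← LinearMap.det_toMatrix Complex.basisOneI, Matrix.det_fin_two]
  simp only [LinearMap.toMatrix_apply, ← Complex.normSq_eq_norm_sq, Complex.normSq_apply]
  simp
  ring

theorem norm_inv_add_sub_mul_conj_le {b z s : ℂ} {C ε : ℝ} (hC : 0 ≤ C) (hε : 0 < ε)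
    (hz : ε < ‖z‖) (hz1 : ‖z‖ ≤ 1) (hs : ‖s‖ ≤ C * ‖z‖ ^ 2)
    (hsmall : 2 * ε * (‖b‖ + C * (1 + ‖b‖)) ≤ 1) :
    ‖(z⁻¹ + (b * z + s)) - b * ε ^ 2 * conj (z⁻¹ + (b * z + s))‖ ≤
      ε⁻¹ + (C * (1 + ‖b‖) + ‖b‖ ^ 2) * ε ^ 2 := by
  set t := ‖z‖ with ht
  set B := ‖b‖ with hB
  have hB0 : 0 ≤ B := norm_nonneg b
  have ht0 : 0 < t := hε.trans hz
  have hz0 : z ≠ 0 := norm_pos_iff.1 ht0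
  have hε1 : ε ≤ 1 := hz.le.trans hz1
  have hconj : conj z⁻¹ = z / t ^ 2 := by
    have : conj z ≠ 0 := by simpa using hz0
    have h2 : z * conj z = t ^ 2 := Complex.mul_conj' z
    rw [map_inv₀, ← h2]
    field_simp
  have hdecomp : (z⁻¹ + (b * z + s)) - b * ε ^ 2 * conj (z⁻¹ + (b * z + s)) =
      z⁻¹ + b * z * ((1 - ε ^ 2 / t ^ 2 : ℝ) : ℂ) + s - b * ε ^ 2 * conj (b * z)
        - b * ε ^ 2 * conj s := by
    rw [map_add, map_add, hconj]
    push_cast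
    ring
  have hεc : ‖(ε : ℂ)‖ = ε := by simp [abs_of_pos hε]
  have hfac : 0 ≤ 1 - ε ^ 2 / t ^ 2 := by
    rw [sub_nonneg, div_le_one (by positivity)]
    gcongr
  have n1 : ‖b * z * ((1 - ε ^ 2 / t ^ 2 : ℝ) : ℂ)‖ = B * t * (1 - ε ^ 2 / t ^ 2) := by
    rw [norm_mul, norm_mul, Complex.norm_real, Real.norm_of_nonneg hfac]
  have n2 : ‖b * ε ^ 2 * conj (b * z)‖ = B * ε ^ 2 * (B * t) := by
    rw [norm_mul, norm_mul, norm_pow, hεc, RCLike.norm_conj, norm_mul]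
  have n3 : ‖b * ε ^ 2 * conj s‖ = B * ε ^ 2 * ‖s‖ := by
    rw [norm_mul, norm_mul, norm_pow, hεc, RCLike.norm_conj]
  have htri : ‖(z⁻¹ + (b * z + s)) - b * ε ^ 2 * conj (z⁻¹ + (b * z + s))‖ ≤
      t⁻¹ + B * t * (1 - ε ^ 2 / t ^ 2) + ‖s‖ + B * ε ^ 2 * (B * t) + B * ε ^ 2 * ‖s‖ := by
    rw [hdecomp, ← n1, ← n2, ← n3, ht, ← norm_inv]
    refine (norm_sub_le _ _).trans (add_le_add_left ?_ _)
    refine (norm_sub_le _ _).trans (add_le_add_left ?_ _)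
    exact norm_add₃_le
  have h1 : B * ε ^ 2 * ‖s‖ ≤ B * (C * t ^ 2) := by
    have : ε ^ 2 ≤ 1 := pow_le_one₀ hε.le hε1
    calc B * ε ^ 2 * ‖s‖ ≤ B * 1 * (C * t ^ 2) := by gcongr
      _ = _ := by ring
  have h2 : B * ε ^ 2 * (B * t) ≤ B ^ 2 * ε ^ 2 := by
    calc B * ε ^ 2 * (B * t) ≤ B * ε ^ 2 * (B * 1) := by gcongr
      _ = _ := by ring
  have h3 : ε⁻¹ + (C * (1 + B) + B ^ 2) * ε ^ 2 - (t⁻¹ + B * t * (1 - ε ^ 2 / t ^ 2) + C * t ^ 2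
      + B ^ 2 * ε ^ 2 + B * (C * t ^ 2)) =
      (t - ε) * (1 - ε * B * (t + ε) - C * (1 + B) * ε * (t * (t + ε))) / (ε * t) := by
    field_simp
    ring
  have h4 : 0 ≤ 1 - ε * B * (t + ε) - C * (1 + B) * ε * (t * (t + ε)) := by
    have a1 : ε * B * (t + ε) ≤ ε * B * 2 := by
      gcongr
      linarith
    have a2 : C * (1 + B) * ε * (t * (t + ε)) ≤ C * (1 + B) * ε * (1 * 2) := by
      gcongr
      linarith
    linarith
  have h5 : 0 ≤ (t - ε) * (1 - ε * B * (t + ε) - C * (1 + B) * ε * (t * (t + ε))) / (ε * t) :=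
    div_nonneg (mul_nonneg (by linarith) h4) (by positivity)
  linarith

theorem exists_norm_sub_deriv_mul_le {u : ℂ → ℂ} (hu : DifferentiableOn ℂ u (ball 0 1))
    (hu0 : u 0 = 0) {r : ℝ} (hr : r < 1) :
    ∃ C, 0 ≤ C ∧ ∀ z, ‖z‖ ≤ r → ‖u z - deriv u 0 * z‖ ≤ C * ‖z‖ ^ 2 := by
  have hn : ball (0 : ℂ) 1 ∈ 𝓝 0 := ball_mem_nhds 0 one_pos
  have hd : DifferentiableOn ℂ (dslope (dslope u 0) 0) (ball 0 1) :=
    (Complex.differentiableOn_dslope hn).2 ((Complex.differentiableOn_dslope hn).2 hu)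
  obtain ⟨C, hC⟩ := (isCompact_closedBall (0 : ℂ) r).exists_bound_of_continuousOn
    (hd.continuousOn.mono (closedBall_subset_ball hr))
  refine ⟨max C 0, le_max_right _ _, fun z hz => ?_⟩
  have h1 := sub_smul_dslope u 0 z
  have h2 := sub_smul_dslope (dslope u 0) 0 z
  rw [dslope_same] at h2
  simp only [hu0, sub_zero, smul_eq_mul] at h1 h2
  have : u z - deriv u 0 * z = dslope (dslope u 0) 0 z * z ^ 2 := by
    rw [← h1]
    linear_combination -z * h2
  rw [this, norm_mul, norm_pow]
  gcongr
  exact (hC z (by simpa using hz)).trans (le_max_left _ _)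

theorem area_estimate {u : ℂ → ℂ} (hu : DifferentiableOn ℂ u (ball 0 1))
    (hinj : InjOn (fun z => z⁻¹ + u z) (ball 0 1 \ {0})) {r C ε : ℝ} (hr : r < 1)
    (hC : 0 ≤ C) (hCu : ∀ z, ‖z‖ ≤ r → ‖u z - deriv u 0 * z‖ ≤ C * ‖z‖ ^ 2)
    (hε : 0 < ε) (hεr : ε ≤ r)
    (hsmall : 2 * ε * (‖deriv u 0‖ + C * (1 + ‖deriv u 0‖)) ≤ 1) :
    (1 - ‖deriv u 0‖ ^ 2 * ε ^ 4) *
        ((ε ^ 2)⁻¹ - (r ^ 2)⁻¹ + ‖deriv u 0‖ ^ 2 * (r ^ 2 - ε ^ 2)) ≤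
      (ε⁻¹ + (C * (1 + ‖deriv u 0‖) + ‖deriv u 0‖ ^ 2) * ε ^ 2) ^ 2 := by
  set b := deriv u 0
  set A : Set ℂ := {z : ℂ | ε < ‖z‖ ∧ ‖z‖ < r}
  set R := ε⁻¹ + (C * (1 + ‖b‖) + ‖b‖ ^ 2) * ε ^ 2 with hR
  have hR0 : 0 ≤ R := by positivity
  set G : ℂ → ℂ := fun z => z⁻¹ + u z with hG
  set M : ℂ →ₗ[ℝ] ℂ :=
    LinearMap.id - (b * ε ^ 2 : ℂ) • (Complex.conjAe.toLinearMap : ℂ →ₗ[ℝ] ℂ) with hM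
  have hdet : LinearMap.det M = 1 - ‖b‖ ^ 2 * ε ^ 4 := by
    rw [hM, det_id_sub_smul_conj]
    simp only [norm_mul, norm_pow, Complex.norm_real, Real.norm_of_nonneg hε.le]
    ring
  have hb : ‖b‖ ^ 2 * ε ^ 4 ≤ 1 := by
    have h1 : ε * ‖b‖ ≤ 1 := by
      have h2 : 0 ≤ ε * ‖b‖ := by positivity
      have h3 : 0 ≤ ε * (C * (1 + ‖b‖)) := by positivity
      linarith
    have h2 : ε ≤ 1 := hεr.trans hr.le
    calc ‖b‖ ^ 2 * ε ^ 4 = (ε * ‖b‖) ^ 2 * ε ^ 2 := by ring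
      _ ≤ 1 ^ 2 * 1 ^ 2 := by gcongr
      _ = 1 := by norm_num
  have hA : MeasurableSet A :=
    ((isOpen_lt continuous_const continuous_norm).inter
      (isOpen_lt continuous_norm continuous_const)).measurableSet
  have hAsub : A ⊆ ball 0 1 \ {0} := by
    intro z hz
    refine ⟨by simpa using hz.2.trans hr, ?_⟩
    rintro rfl
    have := hz.1
    rw [norm_zero] at this
    exact hε.not_gt this
  have hG' : ∀ z ∈ A, HasDerivAt G (deriv u z - (z ^ 2)⁻¹) z := by
    intro z hz
    have h1 := hasDerivAt_inv (hAsub hz).2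
    have h2 := (hu.differentiableAt (isOpen_ball.mem_nhds (hAsub hz).1)).hasDerivAt
    exact (h1.add h2).congr_deriv (by ring)
  have harea : ∫⁻ z in A, ENNReal.ofReal (‖deriv u z - (z ^ 2)⁻¹‖ ^ 2) = volume (G '' A) := by
    rw [← lintegral_abs_det_fderiv_eq_addHaar_image volume hA
      (fun z hz => ((hG' z hz).hasFDerivAt.restrictScalars ℝ).hasFDerivWithinAt)
      (hinj.mono hAsub)]
    refine lintegral_congr fun z => ?_
    congr 1
    simp [ContinuousLinearMap.det, LinearMap.det_restrictScalars,
      Algebra.norm_complex_eq, Complex.normSq_eq_norm_sq]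
  have hsub : M '' (G '' A) ⊆ closedBall 0 R := by
    rintro _ ⟨_, ⟨z, hz, rfl⟩, rfl⟩
    rw [mem_closedBall_zero_iff]
    have := norm_inv_add_sub_mul_conj_le (b := b) hC hε hz.1 (hz.2.trans hr).le
      (hCu z hz.2.le) hsmall
    rw [add_sub_cancel] at this
    exact this
  have hvol := (measure_mono hsub : volume _ ≤ _)
  have hlow := ofReal_le_lintegral_annulus (hu.deriv isOpen_ball) (measurable_deriv u) hε hεr hr
  rw [harea] at hlow
  rw [Measure.addHaar_image_linearMap, Complex.volume_closedBall, hdet,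
    abs_of_nonneg (by linarith), ← ENNReal.ofReal_pow hR0,
    ← ENNReal.ofReal_coe_nnreal, NNReal.coe_real_pi, ← ENNReal.ofReal_mul (by positivity)] at hvol
  have := (mul_le_mul_right hlow (ENNReal.ofReal (1 - ‖b‖ ^ 2 * ε ^ 4))).trans hvol
  rw [← ENNReal.ofReal_mul (by linarith), ENNReal.ofReal_le_ofReal_iff (by positivity)] at this
  have hpi := Real.pi_pos
  refine le_of_mul_le_mul_right (le_trans (le_of_eq ?_) this) hpi
  ring

/-- The first coefficient in the area theorem. -/
theorem norm_deriv_le_one_of_injOn_inv_add {u : ℂ → ℂ} (hu : DifferentiableOn ℂ u (ball 0 1))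
    (hu0 : u 0 = 0) (hinj : InjOn (fun z => z⁻¹ + u z) (ball 0 1 \ {0})) :
    ‖deriv u 0‖ ≤ 1 := by
  have hkey : ∀ r ∈ Ioo (0 : ℝ) 1, ‖deriv u 0‖ ^ 2 * r ^ 2 ≤ (r ^ 2)⁻¹ := by
    rintro r ⟨hr0, hr1⟩
    obtain ⟨C, hC, hCu⟩ := exists_norm_sub_deriv_mul_le hu hu0 hr1
    set B := ‖deriv u 0‖
    set K := C * (1 + B) + B ^ 2
    have hev : ∀ᶠ ε in 𝓝[>] (0 : ℝ),
        B ^ 2 * (r ^ 2 - ε ^ 2) - (r ^ 2)⁻¹ - B ^ 2 * ε ^ 2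
            + B ^ 2 * ε ^ 4 * ((r ^ 2)⁻¹ - B ^ 2 * (r ^ 2 - ε ^ 2)) ≤
          2 * K * ε + K ^ 2 * ε ^ 4 := by
      have hcont : Tendsto (fun ε : ℝ => 2 * ε * (B + C * (1 + B))) (𝓝[>] 0) (𝓝 0) := by
        refine Tendsto.mono_left ?_ nhdsWithin_le_nhds
        exact Continuous.tendsto' (by fun_prop) _ _ (by ring)
      filter_upwards [self_mem_nhdsWithin, mem_nhdsWithin_of_mem_nhds (Iio_mem_nhds hr0),
        hcont.eventually_le_const one_pos] with ε hε hεr hs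
      have hε0 : 0 < ε := hε
      have h := area_estimate hu hinj hr1 hC hCu hε0 (le_of_lt hεr) hs
      have e1 : ε ^ 4 * (ε ^ 2)⁻¹ = ε ^ 2 := by field_simp
      have e2 : (ε⁻¹ + K * ε ^ 2) ^ 2 = (ε ^ 2)⁻¹ + 2 * K * ε + K ^ 2 * ε ^ 4 := by
        field_simp
        ring
      rw [e2] at h
      linear_combination h + B ^ 2 * e1
    have hlim := le_of_tendsto_of_tendsto (b := 𝓝[>] (0 : ℝ))
      (f := fun ε : ℝ => B ^ 2 * (r ^ 2 - ε ^ 2) - (r ^ 2)⁻¹ - B ^ 2 * ε ^ 2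
            + B ^ 2 * ε ^ 4 * ((r ^ 2)⁻¹ - B ^ 2 * (r ^ 2 - ε ^ 2)))
      (g := fun ε => 2 * K * ε + K ^ 2 * ε ^ 4)
      (a₁ := B ^ 2 * r ^ 2 - (r ^ 2)⁻¹) (a₂ := 0)
      ((Continuous.tendsto' (by fun_prop) _ _ (by ring)).mono_left nhdsWithin_le_nhds)
      ((Continuous.tendsto' (by fun_prop) _ _ (by ring)).mono_left nhdsWithin_le_nhds) hev
    linarith
  have hlim : ‖deriv u 0‖ ^ 2 * 1 ^ 2 ≤ ((1 : ℝ) ^ 2)⁻¹ := by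
    refine le_of_tendsto_of_tendsto (b := 𝓝[<] (1 : ℝ))
      (f := fun r : ℝ => ‖deriv u 0‖ ^ 2 * r ^ 2) (g := fun r => (r ^ 2)⁻¹) ?_ ?_ ?_
    · exact ((by fun_prop : Continuous fun r : ℝ => ‖deriv u 0‖ ^ 2 * r ^ 2).tendsto 1).mono_left
        nhdsWithin_le_nhds
    · exact (((continuous_pow 2).tendsto (1 : ℝ)).inv₀ (by norm_num)).mono_left nhdsWithin_le_nhds
    · filter_upwards [Ioo_mem_nhdsLT (zero_lt_one (α := ℝ))] with r hr using hkey r hr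
  have : ‖deriv u 0‖ ^ 2 ≤ 1 := by simpa using hlim
  exact (sq_le_one_iff₀ (norm_nonneg _)).1 this

theorem exists_differentiableOn_sq_eq {k : ℂ → ℂ} (hk : DifferentiableOn ℂ k (ball 0 1))
    (hk0 : k 0 = 1) (hne : ∀ z ∈ ball (0 : ℂ) 1, k z ≠ 0) :
    ∃ q : ℂ → ℂ, DifferentiableOn ℂ q (ball 0 1) ∧ q 0 = 1 ∧
      ∀ z ∈ ball (0 : ℂ) 1, q z ^ 2 = k z := by
  have h0 : (0 : ℂ) ∈ ball (0 : ℂ) 1 := mem_ball_self one_pos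
  obtain ⟨L, hL0, hL⟩ := ((hk.deriv isOpen_ball).div hk hne).isExactOn_ball.with_val_at 0 0
  have hLd : DifferentiableOn ℂ L (ball 0 1) := fun z hz =>
    (hL z hz).differentiableAt.differentiableWithinAt
  refine ⟨fun z => Complex.exp (L z / 2), (hLd.div_const 2).cexp, by simp [hL0], fun z hz => ?_⟩
  have hconst : ∀ w ∈ ball (0 : ℂ) 1, HasDerivAt (fun w => k w * Complex.exp (-L w)) 0 w := by
    intro w hw
    have h1 := (hk.differentiableAt (isOpen_ball.mem_nhds hw)).hasDerivAt
    refine (h1.mul (hL w hw).neg.cexp).congr_deriv ?_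
    have := hne w hw
    simp only [Pi.div_apply]
    field_simp
    ring
  have heq : k z * Complex.exp (-L z) = k 0 * Complex.exp (-L 0) :=
    (convex_ball (0 : ℂ) 1).is_const_of_fderivWithin_eq_zero (𝕜 := ℂ)
      (fun w hw => (hconst w hw).differentiableAt.differentiableWithinAt)
      (fun w hw => by
        rw [fderivWithin_of_isOpen isOpen_ball hw]
        simpa using (hconst w hw).hasFDerivAt.fderiv) hz h0
  rw [hL0, hk0, neg_zero, Complex.exp_zero, mul_one, Complex.exp_neg] at heq
  rw [← Complex.exp_nat_mul]
  have := Complex.exp_ne_zero (L z)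
  field_simp at heq
  rw [heq]
  congr 1
  push_cast
  ring

theorem norm_deriv_le_two_of_injOn_div {k : ℂ → ℂ} (hk : DifferentiableOn ℂ k (ball 0 1))
    (hk0 : k 0 = 1) (hne : ∀ z ∈ ball (0 : ℂ) 1, k z ≠ 0)
    (hinj : InjOn (fun z => k z / z) (ball 0 1 \ {0})) : ‖deriv k 0‖ ≤ 2 := by
  have hn : ball (0 : ℂ) 1 ∈ 𝓝 0 := ball_mem_nhds 0 one_pos
  obtain ⟨q, hq, hq0, hqk⟩ := exists_differentiableOn_sq_eq hk hk0 hne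
  have hsq : MapsTo (fun z : ℂ => z ^ 2) (ball 0 1) (ball 0 1) := by
    intro z hz
    rw [mem_ball_zero_iff] at hz ⊢
    rw [norm_pow]
    exact pow_lt_one₀ (norm_nonneg z) hz two_ne_zero
  have hds : DifferentiableOn ℂ (dslope q 0) (ball 0 1) := (Complex.differentiableOn_dslope hn).2 hq
  set u : ℂ → ℂ := fun z => z * dslope q 0 (z ^ 2) with hu
  have hud : DifferentiableOn ℂ u (ball 0 1) :=
    differentiableOn_id.mul (hds.comp (by fun_prop) hsq)
  have hval : ∀ z : ℂ, z ≠ 0 → z⁻¹ + u z = q (z ^ 2) / z := by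
    intro z hz
    have := sub_smul_dslope q 0 (z ^ 2)
    rw [sub_zero, smul_eq_mul, hq0] at this
    simp only [hu]
    field_simp
    linear_combination this
  have hderivu : deriv u 0 = deriv q 0 := by
    have h1 : DifferentiableAt ℂ (fun z : ℂ => dslope q 0 (z ^ 2)) 0 :=
      (hds.comp (by fun_prop) hsq).differentiableAt hn
    have h2 : deriv u 0 = _ := ((hasDerivAt_id (0 : ℂ)).mul h1.hasDerivAt).deriv
    simpa using h2
  have hderivk : deriv k 0 = 2 * deriv q 0 := by
    have h1 := ((hq.differentiableAt hn).hasDerivAt.pow 2).congr_of_eventuallyEq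
      (f₁ := k) (by filter_upwards [hn] with z hz using (hqk z hz).symm)
    simpa [hq0] using h1.deriv
  have hinju : InjOn (fun z => z⁻¹ + u z) (ball 0 1 \ {0}) := by
    rintro z ⟨hz, hz0⟩ w ⟨hw, hw0⟩ h
    have hz0 : z ≠ 0 := hz0
    have hw0 : w ≠ 0 := hw0
    simp only [hval z hz0, hval w hw0] at h
    have h2 : k (z ^ 2) / z ^ 2 = k (w ^ 2) / w ^ 2 := by
      rw [← hqk _ (hsq hz), ← hqk _ (hsq hw), ← div_pow, ← div_pow, h]
    have h3 : z ^ 2 = w ^ 2 := hinj ⟨hsq hz, pow_ne_zero 2 hz0⟩ ⟨hsq hw, pow_ne_zero 2 hw0⟩ h2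
    rcases sq_eq_sq_iff_eq_or_eq_neg.1 h3 with h4 | h4
    · exact h4
    · exfalso
      have hqw : q (w ^ 2) ≠ 0 := by
        intro h5
        have := hqk _ (hsq hw)
        rw [h5] at this
        exact hne _ (hsq hw) (by rw [← this]; ring)
      rw [h3, h4, div_neg, neg_eq_iff_add_eq_zero, ← two_mul] at h
      exact (mul_ne_zero two_ne_zero (div_ne_zero hqw hw0)) h
  have := norm_deriv_le_one_of_injOn_inv_add hud (by simp [hu]) hinju
  rw [hderivk, ← hderivu, norm_mul, Complex.norm_two]
  linarith

/-- **Koebe quarter theorem** for normalized univalent functions. -/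
theorem koebe_quarter_normalized {F : ℂ → ℂ} (hF : DifferentiableOn ℂ F (ball 0 1))
    (hinj : InjOn F (ball 0 1)) (hF0 : F 0 = 0) (hF1 : deriv F 0 = 1) {w : ℂ}
    (hw : w ∉ F '' ball 0 1) : 1 ≤ 4 * ‖w‖ := by
  have hn : ball (0 : ℂ) 1 ∈ 𝓝 0 := ball_mem_nhds 0 one_pos
  have h0 : (0 : ℂ) ∈ ball (0 : ℂ) 1 := mem_ball_self one_pos
  have hw0 : w ≠ 0 := by
    rintro rfl
    exact hw ⟨0, h0, hF0⟩
  have hφ : DifferentiableOn ℂ (dslope F 0) (ball 0 1) := (Complex.differentiableOn_dslope hn).2 hF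
  have hFφ : ∀ z, F z = z * dslope F 0 z := by
    intro z
    have := sub_smul_dslope F 0 z
    rw [sub_zero, smul_eq_mul, hF0, sub_zero] at this
    exact this.symm
  have hφ0 : dslope F 0 0 = 1 := by rw [dslope_same, hF1]
  have hφne : ∀ z ∈ ball (0 : ℂ) 1, dslope F 0 z ≠ 0 := by
    intro z hz h
    have h1 : F z = F 0 := by rw [hFφ z, h, hF0, mul_zero]
    have h2 := hinj hz h0 h1
    rw [h2, hφ0] at h
    exact one_ne_zero h
  set k : ℂ → ℂ := fun z => (dslope F 0 z)⁻¹ with hk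
  have hkd : DifferentiableOn ℂ k (ball 0 1) := hφ.inv hφne
  have hkF : ∀ z, k z / z = (F z)⁻¹ := by
    intro z
    rw [hFφ z, mul_inv, mul_comm]
    rfl
  have hmain : ∀ c : ℂ, (∀ z ∈ ball (0 : ℂ) 1, F z * c ≠ 1) → ‖deriv k 0 - c‖ ≤ 2 := by
    intro c hc
    have hd : deriv (fun z => k z - c * z) 0 = deriv k 0 - c := by
      have h1 := (hkd.differentiableAt hn).hasDerivAt
      have h2 := h1.sub ((hasDerivAt_id (0 : ℂ)).const_mul c)
      rw [mul_one] at h2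
      exact h2.deriv
    rw [← hd]
    apply norm_deriv_le_two_of_injOn_div
    · exact hkd.sub (by fun_prop)
    · simp [hk, hF1]
    · intro z hz h
      have h1 := hφne z hz
      apply hc z hz
      simp only [hk] at h
      rw [hFφ z]
      field_simp at h
      linear_combination -h
    · rintro z ⟨hz, hz0⟩ w ⟨hw, hw0⟩ h
      have hz0 : z ≠ 0 := hz0
      have hw0 : w ≠ 0 := hw0
      simp only [sub_div, hkF, mul_div_cancel_right₀ _ hz0, mul_div_cancel_right₀ _ hw0] at h
      exact hinj hz hw (inv_injective (sub_left_injective h))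
  have e1 := hmain 0 (by simp)
  have e2 := hmain w⁻¹ (fun z hz h => hw ⟨z, hz, by field_simp at h; exact h⟩)
  have e3 : ‖w⁻¹‖ ≤ 4 := by
    calc ‖w⁻¹‖ = ‖(deriv k 0 - 0) - (deriv k 0 - w⁻¹)‖ := by congr 1; ring
      _ ≤ _ := norm_sub_le _ _
      _ ≤ 4 := by linarith
  rw [norm_inv] at e3
  have hpos : 0 < ‖w‖ := norm_pos_iff.2 hw0
  rwa [inv_le_iff_one_le_mul₀ hpos] at e3

/-- **Koebe quarter theorem** on a disk. -/
theorem koebe_quarter {f : ℂ → ℂ} {z : ℂ} {R : ℝ} (hR : 0 < R)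
    (hf : DifferentiableOn ℂ f (ball z R)) (hinj : InjOn f (ball z R)) {w : ℂ}
    (hw : w ∉ f '' ball z R) : ‖deriv f z‖ * R ≤ 4 * dist (f z) w := by
  by_cases hd : deriv f z = 0
  · rw [hd, norm_zero, zero_mul]
    positivity
  have hRc : (R : ℂ) ≠ 0 := by exact_mod_cast hR.ne'
  set c : ℂ := R * deriv f z with hc
  have hc0 : c ≠ 0 := mul_ne_zero hRc hd
  have hmaps : MapsTo (fun ζ : ℂ => z + R * ζ) (ball 0 1) (ball z R) := by
    intro ζ hζ
    rw [mem_ball_zero_iff] at hζ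
    rw [mem_ball_iff_norm, add_sub_cancel_left, norm_mul, Complex.norm_real,
      Real.norm_of_nonneg hR.le]
    exact mul_lt_of_lt_one_right hR hζ
  have hsub : ∀ a b : ℂ, (a - f z) / c = (b - f z) / c → a = b := by
    intro a b h
    exact sub_left_injective ((div_left_inj' hc0).1 h)
  have := koebe_quarter_normalized (F := fun ζ => (f (z + R * ζ) - f z) / c)
    (w := (w - f z) / c) (((hf.comp (by fun_prop) hmaps).sub_const _).div_const _) ?_ (by simp) ?_ ?_
  · rw [norm_div, ← dist_eq_norm, dist_comm, mul_div_assoc', le_div_iff₀ (norm_pos_iff.2 hc0),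
      one_mul, hc, norm_mul, Complex.norm_real, Real.norm_of_nonneg hR.le, mul_comm] at this
    exact this
  · intro a ha b hb h
    have h1 := hinj (hmaps ha) (hmaps hb) (hsub _ _ h)
    exact mul_left_cancel₀ hRc (add_left_cancel h1)
  · have h1 : HasDerivAt (fun ζ : ℂ => z + R * ζ) R 0 := by
      simpa using ((hasDerivAt_id (0 : ℂ)).const_mul (R : ℂ)).const_add z
    have h2 : HasDerivAt f (deriv f z) (z + R * 0) := by
      rw [mul_zero, add_zero]
      exact (hf.differentiableAt (ball_mem_nhds z hR)).hasDerivAt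
    have h3 := ((h2.comp 0 h1).sub_const (f z)).div_const c
    rw [mul_comm, ← hc, div_self hc0] at h3
    exact h3.deriv
  · rintro ⟨ζ, hζ, h⟩
    exact hw ⟨_, hmaps hζ, hsub _ _ h⟩

theorem not_eventually_eq_of_injOn {D : Set ℂ} (hD : IsOpen D) {f : ℂ → ℂ} (hinj : InjOn f D)
    {z : ℂ} (hz : z ∈ D) : ¬ ∀ᶠ y in 𝓝 z, f y = f z := by
  intro h
  have hinf := infinite_of_mem_nhds z (inter_mem h (hD.mem_nhds hz))
  refine hinf ((finite_singleton z).subset ?_)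
  rintro y ⟨hy, hyD⟩
  exact hinj hyD hz hy

theorem nhds_le_map_of_injOn {D : Set ℂ} (hD : IsOpen D) {f : ℂ → ℂ}
    (hf : DifferentiableOn ℂ f D) (hinj : InjOn f D) {z : ℂ} (hz : z ∈ D) :
    𝓝 (f z) ≤ map f (𝓝 z) :=
  (hf.analyticAt (hD.mem_nhds hz)).eventually_constant_or_nhds_le_map_nhds.resolve_left
    (not_eventually_eq_of_injOn hD hinj hz)

theorem isOpen_image_of_injOn {D : Set ℂ} (hD : IsOpen D) {f : ℂ → ℂ}
    (hf : DifferentiableOn ℂ f D) (hinj : InjOn f D) : IsOpen (f '' D) := by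
  rw [isOpen_iff_mem_nhds]
  rintro _ ⟨z, hz, rfl⟩
  exact nhds_le_map_of_injOn hD hf hinj hz (image_mem_map (hD.mem_nhds hz))

theorem differentiableOn_leftInverse {D : Set ℂ} (hD : IsOpen D) {f g : ℂ → ℂ}
    (hf : DifferentiableOn ℂ f D) (hinj : InjOn f D) (hg : LeftInvOn g f D) :
    DifferentiableOn ℂ g (f '' D) := by
  have hopen := isOpen_image_of_injOn hD hf hinj
  have hright : ∀ w ∈ f '' D, f (g w) = w := by
    rintro _ ⟨z, hz, rfl⟩
    rw [hg hz]
  have hcont : ∀ z ∈ D, ContinuousAt g (f z) := by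
    intro z hz
    rw [ContinuousAt, hg hz]
    refine Tendsto.mono_left ?_ (nhds_le_map_of_injOn hD hf hinj hz)
    rw [tendsto_map'_iff]
    refine tendsto_id.congr' ?_
    filter_upwards [hD.mem_nhds hz] with y hy using (hg hy).symm
  have hreg : ∀ z ∈ D, deriv f z ≠ 0 → DifferentiableAt ℂ g (f z) := by
    intro z hz hne
    refine (HasDerivAt.of_local_left_inverse (f := f) (f' := deriv f z) (hcont z hz) ?_ hne
      ?_).differentiableAt
    · rw [hg hz]
      exact (hf.differentiableAt (hD.mem_nhds hz)).hasDerivAt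
    · filter_upwards [hopen.mem_nhds (mem_image_of_mem f hz)] with w hw using hright w hw
  rintro _ ⟨z, hz, rfl⟩
  refine DifferentiableAt.differentiableWithinAt ?_
  refine (Complex.analyticAt_of_differentiable_on_punctured_nhds_of_continuousAt ?_
    (hcont z hz)).differentiableAt
  have hana : AnalyticAt ℂ (deriv f) z := (hf.analyticAt (hD.mem_nhds hz)).deriv
  have hisol : ∀ᶠ y in 𝓝[≠] z, deriv f y ≠ 0 := by
    refine hana.eventually_eq_zero_or_eventually_ne_zero.resolve_left fun h => ?_
    refine not_eventually_eq_of_injOn hD hinj hz ?_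
    obtain ⟨δ, hδ, hball⟩ := Metric.mem_nhds_iff.1 (inter_mem h (hD.mem_nhds hz))
    filter_upwards [ball_mem_nhds z hδ] with y hy
    refine (convex_ball z δ).is_const_of_fderivWithin_eq_zero (𝕜 := ℂ)
      (hf.mono fun x hx => (hball hx).2) (fun x hx => ?_) hy (mem_ball_self hδ)
    rw [fderivWithin_of_isOpen isOpen_ball hx]
    have hx0 : deriv f x = 0 := (hball hx).1
    ext
    simpa using hx0
  have htend : Tendsto g (𝓝[≠] (f z)) (𝓝[≠] z) := by
    refine tendsto_nhdsWithin_iff.2 ⟨?_, ?_⟩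
    · have := hcont z hz
      rw [ContinuousAt, hg hz] at this
      exact this.mono_left nhdsWithin_le_nhds
    · filter_upwards [self_mem_nhdsWithin,
        mem_nhdsWithin_of_mem_nhds (hopen.mem_nhds (mem_image_of_mem f hz))] with w hw hwD h
      refine hw ?_
      rw [mem_singleton_iff, ← hright w hwD, show g w = z from h]
  filter_upwards [htend.eventually hisol,
    mem_nhdsWithin_of_mem_nhds (hopen.mem_nhds (mem_image_of_mem f hz))] with w hw hwD
  obtain ⟨y, hy, rfl⟩ := hwD
  rw [hg hy] at hw
  exact hreg y hy hw

theorem deriv_leftInverse_mul_deriv {D : Set ℂ} (hD : IsOpen D) {f g : ℂ → ℂ}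
    (hf : DifferentiableOn ℂ f D) (hinj : InjOn f D) (hg : LeftInvOn g f D) {z : ℂ} (hz : z ∈ D) :
    deriv g (f z) * deriv f z = 1 := by
  have h1 := (hf.differentiableAt (hD.mem_nhds hz)).hasDerivAt
  have h2 := ((differentiableOn_leftInverse hD hf hinj hg).differentiableAt
    ((isOpen_image_of_injOn hD hf hinj).mem_nhds (mem_image_of_mem f hz))).hasDerivAt
  refine (h2.comp z h1).unique ((hasDerivAt_id z).congr_of_eventuallyEq ?_)
  filter_upwards [hD.mem_nhds hz] with y hy using hg hy

theorem image_ne_univ_of_injOn {D : Set ℂ} (hD : IsOpen D) (hne : D.Nonempty) (hDu : D ≠ univ)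
    {f : ℂ → ℂ} (hf : DifferentiableOn ℂ f D) (hinj : InjOn f D) : f '' D ≠ univ := by
  intro hu
  obtain ⟨z, hz⟩ := hne
  obtain ⟨w, hw⟩ := (ne_univ_iff_exists_notMem D).1 hDu
  set g := Function.invFunOn f D
  have hg : LeftInvOn g f D := hinj.leftInvOn_invFunOn
  have hgd := differentiableOn_leftInverse hD hf hinj hg
  have hgD : ∀ y, g y ∈ D := fun y =>
    Function.invFunOn_mem (by simp [hu] : y ∈ f '' D)
  have hginj : Function.Injective g := by
    intro a b h
    have ha : f (g a) = a := Function.invFunOn_eq (by simp [hu] : a ∈ f '' D)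
    have hb : f (g b) = b := Function.invFunOn_eq (by simp [hu] : b ∈ f '' D)
    rw [← ha, ← hb, h]
  have hpos : 0 < ‖deriv g (f z)‖ := by
    rw [norm_pos_iff]
    intro h
    have := deriv_leftInverse_mul_deriv hD hf hinj hg hz
    rw [h, zero_mul] at this
    exact zero_ne_one this
  set R := (4 * dist (g (f z)) w + 1) / ‖deriv g (f z)‖ with hR
  have hRpos : 0 < R := by positivity
  have := koebe_quarter hRpos (hgd.mono (by rw [hu]; exact subset_univ _)) hginj.injOn
    (w := w) (z := f z) (by
      rintro ⟨y, -, rfl⟩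
      exact hw (hgD y))
  rw [hR, mul_div_cancel₀ _ hpos.ne'] at this
  linarith

theorem ball_infDist_frontier_subset {D : Set ℂ} {z : ℂ} (hz : z ∈ D) :
    ball z (infDist z (frontier D)) ⊆ D := by
  intro y hy
  by_contra hyD
  have hpos : 0 < infDist z (frontier D) := dist_nonneg.trans_lt hy
  have hfr : ∀ x ∈ ball z (infDist z (frontier D)), x ∉ frontier D := fun x hx hxD => by
    have := infDist_le_dist_of_mem (x := z) hxD
    rw [mem_ball, dist_comm] at hx
    linarith
  obtain ⟨x, -, hx, hx'⟩ := (convex_ball z (infDist z (frontier D))).isPreconnected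
    (interior D) (closure D)ᶜ isOpen_interior isClosed_closure.isOpen_compl
    (fun x hx => by_contra fun h => hfr x hx
      ⟨by_contra fun h' => h (Or.inr h'), fun h' => h (Or.inl h')⟩)
    ⟨z, mem_ball_self hpos, by_contra fun h => hfr z (mem_ball_self hpos) ⟨subset_closure hz, h⟩⟩
    ⟨y, hy, fun h => hfr y hy ⟨h, fun h' => hyD (interior_subset h')⟩⟩
  exact hx' (interior_subset_closure hx)

theorem norm_deriv_mul_infDist_frontier_le {D : Set ℂ} {f : ℂ → ℂ}
    (hf : DifferentiableOn ℂ f D) (hinj : InjOn f D) (hopen : IsOpen (f '' D))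
    (hfr : (frontier (f '' D)).Nonempty) {z : ℂ} (hz : z ∈ D) :
    ‖deriv f z‖ * infDist z (frontier D) ≤ 4 * infDist (f z) (frontier (f '' D)) := by
  rcases (infDist_nonneg (x := z) (s := frontier D)).eq_or_lt with h | h
  · rw [← h, mul_zero]
    exact mul_nonneg (by norm_num) infDist_nonneg
  have hsub := ball_infDist_frontier_subset hz
  rw [← div_le_iff₀' (by norm_num : (0 : ℝ) < 4), le_infDist hfr]
  intro w hw
  rw [div_le_iff₀' (by norm_num : (0 : ℝ) < 4)]
  refine koebe_quarter h (hf.mono hsub) (hinj.mono hsub) fun hmem => ?_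
  rw [hopen.frontier_eq] at hw
  exact hw.2 (image_mono hsub hmem)

theorem infDist_frontier_pos {D : Set ℂ} (hD : IsOpen D) (hfr : (frontier D).Nonempty) {z : ℂ}
    (hz : z ∈ D) : 0 < infDist z (frontier D) := by
  rw [← isClosed_frontier.notMem_iff_infDist_pos hfr, hD.frontier_eq]
  exact fun h => h.2 hz

theorem intervalIntegrable_norm_deriv_div_infDist {D : Set ℂ} (hD : IsOpen D)
    (hfr : (frontier D).Nonempty) {γ : ℝ → ℂ} (hγ : ContDiffOn ℝ 1 γ (Icc 0 1))
    (hγD : ∀ t ∈ Icc (0 : ℝ) 1, γ t ∈ D) :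
    IntervalIntegrable (fun t => ‖deriv γ t‖ / infDist (γ t) (frontier D)) volume 0 1 := by
  have h1 : ContinuousOn (fun t => ‖derivWithin γ (Icc 0 1) t‖ / infDist (γ t) (frontier D))
      (Icc (0 : ℝ) 1) :=
    (hγ.continuousOn_derivWithin (uniqueDiffOn_Icc zero_lt_one) le_rfl).norm.div
      ((continuous_infDist_pt _).comp_continuousOn hγ.continuousOn)
      fun t ht => (infDist_frontier_pos hD hfr (hγD t ht)).ne'
  rw [← uIcc_of_le (zero_le_one (α := ℝ))] at h1
  refine h1.intervalIntegrable.congr_uIoo ?_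
  intro t ht
  rw [uIoo_of_le zero_le_one] at ht
  simp only
  rw [uIcc_of_le zero_le_one, derivWithin_of_mem_nhds (Icc_mem_nhds ht.1 ht.2)]

theorem qhDist_image_le {D : Set ℂ} (hD : IsOpen D) (hfr : (frontier D).Nonempty) {f g : ℂ → ℂ}
    (hf : DifferentiableOn ℂ f D) (hinj : InjOn f D) (hg : LeftInvOn g f D)
    (hfr' : (frontier (f '' D)).Nonempty) {z₁ z₂ : ℂ} (hz₁ : z₁ ∈ D) (hz₂ : z₂ ∈ D) :
    qhDist (f '' D) (f z₁) (f z₂) ≤ 4 * qhDist D z₁ z₂ := by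
  have hopen := isOpen_image_of_injOn hD hf hinj
  have hgd := differentiableOn_leftInverse hD hf hinj hg
  have hfc : ContDiffOn ℝ 1 f D := (hf.contDiffOn hD).restrict_scalars ℝ
  have hgc : ContDiffOn ℝ 1 g (f '' D) := (hgd.contDiffOn hopen).restrict_scalars ℝ
  unfold qhDist
  set S := {L : ℝ | ∃ γ : ℝ → ℂ, ContDiffOn ℝ 1 γ (Set.Icc 0 1) ∧ γ 0 = z₁ ∧ γ 1 = z₂ ∧
    (∀ t ∈ Set.Icc (0 : ℝ) 1, γ t ∈ D) ∧
    L = ∫ t in (0 : ℝ)..1, ‖deriv γ t‖ / Metric.infDist (γ t) (frontier D)}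
  set S' := {L : ℝ | ∃ γ : ℝ → ℂ, ContDiffOn ℝ 1 γ (Set.Icc 0 1) ∧ γ 0 = f z₁ ∧ γ 1 = f z₂ ∧
    (∀ t ∈ Set.Icc (0 : ℝ) 1, γ t ∈ f '' D) ∧
    L = ∫ t in (0 : ℝ)..1, ‖deriv γ t‖ / Metric.infDist (γ t) (frontier (f '' D))}
  rcases S.eq_empty_or_nonempty with hS | hS
  · have hS' : S' = ∅ := by
      rw [eq_empty_iff_forall_notMem]
      rintro _ ⟨γ, hγ, h0, h1, hγD, -⟩
      have : (∫ t in (0 : ℝ)..1, ‖deriv (g ∘ γ) t‖ / infDist ((g ∘ γ) t) (frontier D)) ∈ S := by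
        refine ⟨g ∘ γ, hgc.comp hγ hγD, ?_, ?_, ?_, rfl⟩
        · rw [Function.comp_apply, h0, hg hz₁]
        · rw [Function.comp_apply, h1, hg hz₂]
        · intro t ht
          obtain ⟨y, hy, hyt⟩ := hγD t ht
          rw [Function.comp_apply, ← hyt, hg hy]
          exact hy
      rw [hS] at this
      exact this
    rw [hS, hS', Real.sInf_empty, mul_zero]
  rw [← div_le_iff₀' (by norm_num : (0 : ℝ) < 4)]
  refine le_csInf hS ?_
  rintro _ ⟨γ, hγ, h0, h1, hγD, rfl⟩
  rw [div_le_iff₀' (by norm_num : (0 : ℝ) < 4)]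
  have hbdd : BddBelow S' := by
    refine ⟨0, ?_⟩
    rintro _ ⟨η, -, -, -, -, rfl⟩
    exact intervalIntegral.integral_nonneg zero_le_one fun t _ =>
      div_nonneg (norm_nonneg _) infDist_nonneg
  have hfγ : ContDiffOn ℝ 1 (f ∘ γ) (Icc 0 1) := hfc.comp hγ hγD
  have hfγD : ∀ t ∈ Icc (0 : ℝ) 1, (f ∘ γ) t ∈ f '' D := fun t ht => mem_image_of_mem f (hγD t ht)
  refine (csInf_le hbdd ⟨f ∘ γ, hfγ, by simp [h0], by simp [h1], hfγD, rfl⟩).trans ?_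
  rw [← intervalIntegral.integral_const_mul]
  refine intervalIntegral.integral_mono_on_of_le_Ioo zero_le_one
    (intervalIntegrable_norm_deriv_div_infDist hopen hfr' hfγ hfγD)
    ((intervalIntegrable_norm_deriv_div_infDist hD hfr hγ hγD).const_mul 4) ?_
  intro t ht
  have htD := hγD t (Ioo_subset_Icc_self ht)
  have hγt : HasDerivAt γ (deriv γ t) t :=
    ((hγ.differentiableOn one_ne_zero).differentiableAt (Icc_mem_nhds ht.1 ht.2)).hasDerivAt
  have hft := (hf.differentiableAt (hD.mem_nhds htD)).hasDerivAt
  rw [(hft.comp_of_eq t hγt rfl).deriv, norm_mul, mul_div_assoc', Function.comp_apply,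
    div_le_div_iff₀ (infDist_frontier_pos hopen hfr' (mem_image_of_mem f htD))
      (infDist_frontier_pos hD hfr htD)]
  have := mul_le_mul_of_nonneg_left
    (norm_deriv_mul_infDist_frontier_le hf hinj hopen hfr' htD) (norm_nonneg (deriv γ t))
  linarith

/-- If `D ⊊ ℂ` is a domain and `f` is conformal on `D`, then for all
`z₁, z₂ ∈ D`, `(1/4) k_D(z₁,z₂) ≤ k_{f(D)}(f(z₁), f(z₂)) ≤ 4 k_D(z₁,z₂)`,
where `k_Ω` denotes the quasihyperbolic distance. -/
theorem conformal_quasihyperbolic_dist_bounds (D : Set ℂ)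
    (hDo : IsOpen D) (hDc : IsConnected D) (hDp : D ≠ Set.univ)
    (f : ℂ → ℂ) (hf : DifferentiableOn ℂ f D) (hinj : Set.InjOn f D) :
    ∀ z₁ ∈ D, ∀ z₂ ∈ D,
      (1 / 4) * qhDist D z₁ z₂ ≤ qhDist (f '' D) (f z₁) (f z₂) ∧
        qhDist (f '' D) (f z₁) (f z₂) ≤ 4 * qhDist D z₁ z₂ := by
  intro z₁ hz₁ z₂ hz₂
  have hfr : (frontier D).Nonempty := nonempty_frontier_iff.2 ⟨hDc.nonempty, hDp⟩
  have hfr' : (frontier (f '' D)).Nonempty := nonempty_frontier_iff.2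
    ⟨hDc.nonempty.image f, image_ne_univ_of_injOn hDo hDc.nonempty hDp hf hinj⟩
  have hg : LeftInvOn (Function.invFunOn f D) f D := hinj.leftInvOn_invFunOn
  have hright : LeftInvOn f (Function.invFunOn f D) (f '' D) := by
    rintro _ ⟨z, hz, rfl⟩
    rw [hg hz]
  have himage : Function.invFunOn f D '' (f '' D) = D := hg.image_image
  refine ⟨?_, qhDist_image_le hDo hfr hf hinj hg hfr' hz₁ hz₂⟩
  have h := qhDist_image_le (isOpen_image_of_injOn hDo hf hinj) hfr'
    (differentiableOn_leftInverse hDo hf hinj hg) hright.injOn hright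
    (by rwa [himage]) (mem_image_of_mem f hz₁) (mem_image_of_mem f hz₂)
  rw [himage, hg hz₁, hg hz₂] at h
  linarith
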